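/- (Theorem 1, general case.) For a feedforward ReLU network with K hidden layers of widths M₁,…,M_K, the map sending a tuple of permutations (σ₁,…,σ_K) ∈ ∏_{i=1}^K Perm(Fin M_i) to the linear automorphism of the parameter space ℝ^q that simultaneously permutes, for each hidden layer i, the rows of W_i and entries of b_i by σ_i and the columns of W_{i+1} by σ_i, is an injective group homomorphism into GL(q, ℝ) whose image is contained in the set T of network-function-preserving invertible linear transformations; consequently T contains at least ∏_{i=1}^K M_i! elements. -/

import Mathlib

/-- Parameter space of a feedforward ReLU network with `K` hidden layers and layer
widths `d 0` (input), `d 1, …, d K` (hidden), `d (K+1)` (output): for each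
`i = 0, …, K`, a weight matrix `W_{i+1} : Matrix (Fin (d (i+1))) (Fin (d i)) ℝ` and a
bias vector `b_{i+1} : Fin (d (i+1)) → ℝ`. -/
abbrev ParamsK (K : ℕ) (d : ℕ → ℕ) : Type :=
  (i : Fin (K + 1)) → Matrix (Fin (d (i.1 + 1))) (Fin (d i.1)) ℝ × (Fin (d (i.1 + 1)) → ℝ)

/-- The activations of the network: `h_0 = x` and
`h_m = ReLU(W_m h_{m-1} + b_m)` componentwise, for `1 ≤ m ≤ K`. -/
def layerOut (K : ℕ) (d : ℕ → ℕ) (θ : ParamsK K d) (x : Fin (d 0) → ℝ) :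
    (m : ℕ) → m ≤ K → (Fin (d m) → ℝ)
  | 0, _ => x
  | m + 1, h => fun a =>
      max 0 ((∑ l, (θ ⟨m, by omega⟩).1 a l * layerOut K d θ x m (by omega) l)
        + (θ ⟨m, by omega⟩).2 a)

/-- The function computed by the feedforward ReLU network:
`N_θ(x) = W_{K+1} h_K + b_{K+1}`. -/
def netK (K : ℕ) (d : ℕ → ℕ) (θ : ParamsK K d) (x : Fin (d 0) → ℝ) :
    Fin (d (K + 1)) → ℝ :=
  fun a => (∑ l, (θ ⟨K, by omega⟩).1 a l * layerOut K d θ x K (le_refl K) l)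
    + (θ ⟨K, by omega⟩).2 a

/-- `T`: the set of invertible linear maps `g` of the parameter space such that for
every parameter vector `θ` and every input `x`, `N_{g(θ)}(x) = N_θ(x)`. -/
def TSetK (K : ℕ) (d : ℕ → ℕ) : Set (ParamsK K d ≃ₗ[ℝ] ParamsK K d) :=
  {g | ∀ (θ : ParamsK K d) (x : Fin (d 0) → ℝ), netK K d (g θ) x = netK K d θ x}

/-- Extension of a tuple of hidden-layer permutations `(σ₁, …, σ_K)` to all layers:
the layer-`m` permutation for `1 ≤ m ≤ K`, and the identity on the input and output
layers. -/
def extPerm (K : ℕ) (d : ℕ → ℕ) (s : (i : Fin K) → Equiv.Perm (Fin (d (i.1 + 1))))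
    (m : ℕ) : Equiv.Perm (Fin (d m)) :=
  if h : 1 ≤ m ∧ m ≤ K then
    Equiv.permCongr (finCongr (congrArg d (Nat.succ_pred_eq_of_pos h.1)))
      (s ⟨m - 1, by omega⟩)
  else 1

/-- The simultaneous permutation of all hidden layers: for each hidden layer `i`, the
rows of `W_i` and the entries of `b_i` are permuted by `σ_i` and the columns of
`W_{i+1}` are permuted by `σ_i` (input and output coordinates untouched). -/
def permuteAll (K : ℕ) (d : ℕ → ℕ) (s : (i : Fin K) → Equiv.Perm (Fin (d (i.1 + 1))))
    (θ : ParamsK K d) : ParamsK K d :=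
  fun j =>
    (Matrix.of fun a l => (θ j).1 (extPerm K d s (j.1 + 1) a) (extPerm K d s j.1 l),
     fun a => (θ j).2 (extPerm K d s (j.1 + 1) a))

theorem extPerm_zero (K : ℕ) (d : ℕ → ℕ)
    (s : (i : Fin K) → Equiv.Perm (Fin (d (i.1 + 1)))) : extPerm K d s 0 = 1 := by
  simp [extPerm]

theorem extPerm_last (K : ℕ) (d : ℕ → ℕ)
    (s : (i : Fin K) → Equiv.Perm (Fin (d (i.1 + 1)))) : extPerm K d s (K + 1) = 1 := by
  simp [extPerm]

theorem extPerm_succ (K : ℕ) (d : ℕ → ℕ)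
    (s : (i : Fin K) → Equiv.Perm (Fin (d (i.1 + 1)))) (i : Fin K) :
    extPerm K d s (i.1 + 1) = s i := by
  have h : 1 ≤ i.1 + 1 ∧ i.1 + 1 ≤ K := ⟨by omega, i.2⟩
  rw [extPerm, dif_pos h]
  rfl

theorem extPerm_one (K : ℕ) (d : ℕ → ℕ) (m : ℕ) : extPerm K d 1 m = 1 := by
  unfold extPerm
  split_ifs
  · ext a
    simp [Equiv.permCongr_apply]
  · rfl

theorem extPerm_mul (K : ℕ) (d : ℕ → ℕ)
    (s t : (i : Fin K) → Equiv.Perm (Fin (d (i.1 + 1)))) (m : ℕ) :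
    extPerm K d (s * t) m = extPerm K d s m * extPerm K d t m := by
  unfold extPerm
  split_ifs
  · ext a
    simp [Equiv.permCongr_apply]
  · simp

theorem permuteAll_one (K : ℕ) (d : ℕ → ℕ) (θ : ParamsK K d) : permuteAll K d 1 θ = θ := by
  funext j
  simp only [permuteAll, extPerm_one, Equiv.Perm.one_apply]
  rfl

theorem permuteAll_mul (K : ℕ) (d : ℕ → ℕ)
    (s t : (i : Fin K) → Equiv.Perm (Fin (d (i.1 + 1)))) (θ : ParamsK K d) :
    permuteAll K d (s * t) θ = permuteAll K d t (permuteAll K d s θ) := by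
  funext j
  simp only [permuteAll, extPerm_mul, Equiv.Perm.mul_apply, Matrix.of_apply]

/-- Permuting all hidden layers permutes the activations. -/
theorem layerOut_permuteAll (K : ℕ) (d : ℕ → ℕ)
    (s : (i : Fin K) → Equiv.Perm (Fin (d (i.1 + 1)))) (θ : ParamsK K d)
    (x : Fin (d 0) → ℝ) (m : ℕ) (hm : m ≤ K) (a : Fin (d m)) :
    layerOut K d (permuteAll K d s θ) x m hm a = layerOut K d θ x m hm (extPerm K d s m a) := by
  induction m with
  | zero => simp [layerOut, extPerm_zero]
  | succ m ih =>
    simp only [layerOut, permuteAll, Matrix.of_apply] at ih ⊢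
    simp only [ih]
    rw [Equiv.sum_comp (extPerm K d s m) fun l =>
      (θ ⟨m, by omega⟩).1 (extPerm K d s (m + 1) a) l * layerOut K d θ x m (by omega) l]

theorem netK_permuteAll (K : ℕ) (d : ℕ → ℕ)
    (s : (i : Fin K) → Equiv.Perm (Fin (d (i.1 + 1)))) (θ : ParamsK K d)
    (x : Fin (d 0) → ℝ) : netK K d (permuteAll K d s θ) x = netK K d θ x := by
  funext a
  simp only [netK, layerOut_permuteAll]
  simp only [permuteAll, Matrix.of_apply, extPerm_last, Equiv.Perm.one_apply]
  rw [Equiv.sum_comp (extPerm K d s K) fun l =>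
    (θ ⟨K, by omega⟩).1 a l * layerOut K d θ x K le_rfl l]

theorem permuteAll_injective (K : ℕ) (d : ℕ → ℕ) : Function.Injective (permuteAll K d) := by
  intro s t h
  funext i
  ext a : 1
  have hb := congrArg (fun p => p.2 a) (congrFun (congrFun h fun j =>
    (0, fun b => (b.1 : ℝ))) i.castSucc)
  simp only [permuteAll, Fin.val_castSucc, extPerm_succ] at hb
  exact Fin.ext (Nat.cast_injective hb)

/-- The action of tuples of hidden-layer permutations on the parameter space. -/
def permuteAllHom (K : ℕ) (d : ℕ → ℕ) :
    ((i : Fin K) → Equiv.Perm (Fin (d (i.1 + 1)))) →* (ParamsK K d ≃ₗ[ℝ] ParamsK K d) where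
  toFun s :=
    { toFun := permuteAll K d s⁻¹
      invFun := permuteAll K d s
      map_add' := fun _ _ => rfl
      map_smul' := fun _ _ => rfl
      left_inv := fun θ => by rw [← permuteAll_mul, inv_mul_cancel, permuteAll_one]
      right_inv := fun θ => by rw [← permuteAll_mul, mul_inv_cancel, permuteAll_one] }
  map_one' := by
    ext1 θ
    exact (congrArg (permuteAll K d · θ) inv_one).trans (permuteAll_one K d θ)
  map_mul' s t := by
    ext1 θ
    exact (congrArg (permuteAll K d · θ) (mul_inv_rev s t)).trans
      (permuteAll_mul K d t⁻¹ s⁻¹ θ)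

theorem permuteAllHom_apply (K : ℕ) (d : ℕ → ℕ)
    (s : (i : Fin K) → Equiv.Perm (Fin (d (i.1 + 1)))) (θ : ParamsK K d) :
    permuteAllHom K d s θ = permuteAll K d s⁻¹ θ := rfl

theorem permuteAllHom_injective (K : ℕ) (d : ℕ → ℕ) :
    Function.Injective (permuteAllHom K d) := fun _ _ h =>
  inv_injective (permuteAll_injective K d (funext fun θ => LinearEquiv.congr_fun h θ))

theorem permuteAllHom_mem_TSetK (K : ℕ) (d : ℕ → ℕ)
    (s : (i : Fin K) → Equiv.Perm (Fin (d (i.1 + 1)))) :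
    permuteAllHom K d s ∈ TSetK K d :=
  netK_permuteAll K d s⁻¹

/-- Theorem 1, general case: the map sending a tuple of permutations
`(σ₁, …, σ_K)` of the hidden layers to the linear automorphism of the parameter space
that simultaneously permutes, for each hidden layer `i`, the rows of `W_i` and the
entries of `b_i` by `σ_i` and the columns of `W_{i+1}` by `σ_i` (the hidden-layer-`i`
parameter block indexed by `j` being moved to position `σ_i(j)`, i.e.
`Φ s θ = permuteAll s⁻¹ θ`), is an injective group homomorphism into `GL(q, ℝ)` whose
image is contained in the set `T` of network-function-preserving invertible linear
transformations; consequently `T` contains at least `∏_{i=1}^K M_i!` elements. -/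
theorem perm_tuple_monoidHom_into_T (K : ℕ) (d : ℕ → ℕ) :
    ∃ Φ : ((i : Fin K) → Equiv.Perm (Fin (d (i.1 + 1)))) →*
        (ParamsK K d ≃ₗ[ℝ] ParamsK K d),
      Function.Injective Φ ∧
      (∀ (s : (i : Fin K) → Equiv.Perm (Fin (d (i.1 + 1)))) (θ : ParamsK K d),
        Φ s θ = permuteAll K d s⁻¹ θ) ∧
      (∀ s, Φ s ∈ TSetK K d) ∧
      Nat.card ((i : Fin K) → Equiv.Perm (Fin (d (i.1 + 1))))
        = ∏ i : Fin K, Nat.factorial (d (i.1 + 1)) ∧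
      (∃ f : ((i : Fin K) → Equiv.Perm (Fin (d (i.1 + 1)))) → ↥(TSetK K d),
        Function.Injective f) := by
  refine ⟨permuteAllHom K d, permuteAllHom_injective K d, permuteAllHom_apply K d,
    permuteAllHom_mem_TSetK K d, ?_,
    fun s => ⟨permuteAllHom K d s, permuteAllHom_mem_TSetK K d s⟩,
    fun _ _ h => permuteAllHom_injective K d (congrArg Subtype.val h)⟩
  simp [Fintype.card_perm]
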